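/- arXiv:math/0703607 — 3 statements merged into one kernel-verified Lean document; each statement's English description precedes it below -/
import Mathlib

section
/- Let d ≥ 1, m ≥ 2, distinct points p_0,…,p_{m−1} ∈ ℝ^d whose convex hull Ω has nonempty interior, λ ∈ (0,1), and f_j(x) = λx + (1−λ)p_j. Assume Ω = ⋃_j f_j(Ω) and that there exist i ≠ k and an extreme point p_j of Ω with f_k(p_j) in the interior of f_i(Ω). Let (p'_0,…,p'_{m−1}) be a probability vector with p'_s > 0 for all s, let ρ be the corresponding product (Bernoulli) measure on Σ = {0,…,m−1}^ℕ, let π : Σ → ℝ^d be the coding map π(i_1,i_2,…) = (λ⁻¹ − 1)·∑_{n=1}^∞ λ^n p_{i_n}, and let μ = π_*ρ be the push-forward measure. Then μ({ x : the set of addresses of x has cardinality < 2^ℵ₀ }) = 0; i.e., μ-almost every x has 2^ℵ₀ distinct addresses. -/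
open MeasureTheory Filter Topology

section Words

variable {ι : Type*}

/-- The sequence which begins with the first `n` letters of `ω` and continues with `τ`. -/
def appendAt (ω : ℕ → ι) (n : ℕ) (τ : ℕ → ι) : ℕ → ι :=
  fun l => if l < n then ω l else τ (l - n)

lemma appendAt_mem_cylinder (ω : ℕ → ι) (n : ℕ) (τ : ℕ → ι) :
    appendAt ω n τ ∈ PiNat.cylinder (E := fun _ => ι) ω n :=
  fun l hl => by simp [appendAt, hl]

lemma appendAt_add (ω : ℕ → ι) (n : ℕ) (τ : ℕ → ι) :
    (fun l => appendAt ω n τ (n + l)) = τ := by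
  funext l
  simp [appendAt]

lemma shift_mem_cylinder {ω τ ζ : ℕ → ι} {n k : ℕ}
    (hζ : ζ ∈ PiNat.cylinder (E := fun _ => ι) (appendAt ω n τ) (n + k)) :
    (fun l => ζ (n + l)) ∈ PiNat.cylinder (E := fun _ => ι) τ k := by
  intro l hl
  have := hζ (n + l) (by omega)
  simpa [appendAt] using this

lemma mem_cylinder_of_append {ω τ ζ : ℕ → ι} {n k : ℕ}
    (hζ : ζ ∈ PiNat.cylinder (E := fun _ => ι) (appendAt ω n τ) (n + k)) :
    ζ ∈ PiNat.cylinder (E := fun _ => ι) ω n := by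
  intro l hl
  have := hζ l (by omega)
  simpa [appendAt, hl] using this

end Words

section Coding

lemma exists_dist_bound {E : Type*} [NormedAddCommGroup E] {Ω : Set E} (hΩ : IsCompact Ω) :
    ∃ B : ℝ, ∀ x ∈ Ω, ∀ y ∈ Ω, ‖x - y‖ ≤ B :=
  ⟨Metric.diam Ω, fun x hx y hy => by
    rw [← dist_eq_norm]
    exact Metric.dist_le_diam_of_mem hΩ.isBounded hx hy⟩

variable {ι E : Type*} [NormedAddCommGroup E] [NormedSpace ℝ E]

/-- The composition `f_{ω 0} ∘ ⋯ ∘ f_{ω (n - 1)}` of the maps `f_s x = lam • x + (1 - lam) • p s`. -/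
def blockMap (lam : ℝ) (p : ι → E) (ω : ℕ → ι) (n : ℕ) (x : E) : E :=
  lam ^ n • x + (1 - lam) • ∑ l ∈ Finset.range n, lam ^ l • p (ω l)

/-- The coding map of the iterated function system. -/
noncomputable def codeMap (lam : ℝ) (p : ι → E) (ω : ℕ → ι) : E :=
  (lam⁻¹ - 1) • ∑' n : ℕ, lam ^ (n + 1) • p (ω n)

variable {lam : ℝ} {p : ι → E}

lemma blockMap_sub (ω : ℕ → ι) (n : ℕ) (x y : E) :
    blockMap lam p ω n x - blockMap lam p ω n y = lam ^ n • (x - y) := by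
  simp [blockMap, smul_sub]

lemma blockMap_congr {ω η : ℕ → ι} {n : ℕ} (h : η ∈ PiNat.cylinder (E := fun _ => ι) ω n) :
    blockMap lam p η n = blockMap lam p ω n := by
  funext x
  unfold blockMap
  rw [Finset.sum_congr rfl fun l hl => by rw [h l (Finset.mem_range.1 hl)]]

lemma blockMap_add (ω : ℕ → ι) (n k : ℕ) (x : E) :
    blockMap lam p ω (n + k) x =
      blockMap lam p ω n (blockMap lam p (fun l => ω (n + l)) k x) := by
  simp only [blockMap, Finset.sum_range_add, smul_add, pow_add, Finset.smul_sum, smul_smul]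
  rw [add_assoc, add_comm (∑ l ∈ Finset.range n, _)]
  congr 2
  refine Finset.sum_congr rfl fun l _ => ?_
  congr 1
  ring

lemma blockMap_one (ω : ℕ → ι) (x : E) :
    blockMap lam p ω 1 x = lam • x + (1 - lam) • p (ω 0) := by
  simp [blockMap]

lemma continuous_blockMap (ω : ℕ → ι) (n : ℕ) : Continuous (blockMap lam p ω n) := by
  unfold blockMap
  fun_prop

lemma isOpen_blockMap_image (h0 : 0 < lam) (ω : ℕ → ι) (n : ℕ) {O : Set E} (hO : IsOpen O) :
    IsOpen (blockMap lam p ω n '' O) := by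
  have hne : lam ^ n ≠ 0 := (pow_pos h0 n).ne'
  have h : blockMap lam p ω n '' O =
      (fun x => (lam ^ n)⁻¹ •
        (x - (1 - lam) • ∑ l ∈ Finset.range n, lam ^ l • p (ω l))) ⁻¹' O := by
    ext x
    constructor
    · rintro ⟨y, hy, rfl⟩
      simpa [blockMap, hne] using hy
    · intro hx
      exact ⟨_, hx, by simp [blockMap, hne]⟩
  rw [h]
  exact hO.preimage (by fun_prop)

lemma blockMap_mem {Ω : Set E} (hmaps : ∀ s, ∀ x ∈ Ω, lam • x + (1 - lam) • p s ∈ Ω)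
    (ω : ℕ → ι) (n : ℕ) {x : E} (hx : x ∈ Ω) : blockMap lam p ω n x ∈ Ω := by
  induction n generalizing x with
  | zero => simpa [blockMap] using hx
  | succ n ih =>
    rw [blockMap_add, blockMap_one]
    exact ih (hmaps _ _ hx)

variable [Finite ι]

omit [NormedSpace ℝ E] in
lemma exists_norm_le (p : ι → E) : ∃ B : ℝ, ∀ s, ‖p s‖ ≤ B := by
  obtain ⟨B, hB⟩ := (Set.finite_range fun s => ‖p s‖).bddAbove
  exact ⟨B, fun s => hB ⟨s, rfl⟩⟩

lemma exists_summable_bound (h0 : 0 < lam) (h1 : lam < 1) (p : ι → E) :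
    ∃ u : ℕ → ℝ, Summable u ∧ ∀ n s, ‖lam ^ (n + 1) • p s‖ ≤ u n := by
  obtain ⟨B, hB⟩ := exists_norm_le p
  refine ⟨fun n => lam ^ n * (lam * B), (summable_geometric_of_lt_one h0.le h1).mul_right _,
    fun n s => ?_⟩
  rw [norm_smul, Real.norm_of_nonneg (by positivity), pow_succ, mul_assoc]
  dsimp only
  gcongr
  exact hB s

variable [CompleteSpace E]

lemma summable_code (h0 : 0 < lam) (h1 : lam < 1) (ω : ℕ → ι) :
    Summable fun n => lam ^ (n + 1) • p (ω n) := by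
  obtain ⟨u, hu, hb⟩ := exists_summable_bound h0 h1 p
  exact hu.of_norm_bounded fun n => hb n _

lemma continuous_codeMap [TopologicalSpace ι] [DiscreteTopology ι] (h0 : 0 < lam) (h1 : lam < 1) :
    Continuous (codeMap lam p) := by
  obtain ⟨u, hu, hb⟩ := exists_summable_bound h0 h1 p
  refine Continuous.const_smul (continuous_tsum (fun n => ?_) hu fun n ω => hb n _) _
  exact ((continuous_of_discreteTopology (f := p)).comp (continuous_apply n)).const_smul _

omit [Finite ι] [CompleteSpace E] in
lemma smul_sum_code (h0 : 0 < lam) (ω : ℕ → ι) (n : ℕ) :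
    (lam⁻¹ - 1) • ∑ l ∈ Finset.range n, lam ^ (l + 1) • p (ω l) =
      (1 - lam) • ∑ l ∈ Finset.range n, lam ^ l • p (ω l) := by
  simp only [Finset.smul_sum, smul_smul]
  refine Finset.sum_congr rfl fun l _ => ?_
  congr 1
  field_simp
  ring

lemma codeMap_eq_blockMap (h0 : 0 < lam) (h1 : lam < 1) (ω : ℕ → ι) (n : ℕ) :
    codeMap lam p ω = blockMap lam p ω n (codeMap lam p fun l => ω (n + l)) := by
  unfold codeMap blockMap
  rw [← (summable_code h0 h1 ω).sum_add_tsum_nat_add n, smul_add, smul_sum_code h0, add_comm]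
  congr 1
  rw [smul_comm, ← tsum_const_smul'' (lam ^ n)]
  congr 1
  refine tsum_congr fun l => ?_
  rw [smul_smul, add_comm l n]
  congr 1
  ring

lemma tendsto_blockMap (h0 : 0 < lam) (h1 : lam < 1) (ω : ℕ → ι) (x : E) :
    Tendsto (fun n => blockMap lam p ω n x) atTop (𝓝 (codeMap lam p ω)) := by
  have hx : Tendsto (fun n : ℕ => lam ^ n • x) atTop (𝓝 0) := by
    simpa using (tendsto_pow_atTop_nhds_zero_of_lt_one h0.le h1).smul_const x
  have hs := ((summable_code (p := p) h0 h1 ω).hasSum.tendsto_sum_nat).const_smul (lam⁻¹ - 1)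
  simpa [blockMap, codeMap, smul_sum_code h0] using hx.add hs

variable {Ω : Set E}

lemma codeMap_mem (h0 : 0 < lam) (h1 : lam < 1) (hΩ : IsCompact Ω) (hne : Ω.Nonempty)
    (hmaps : ∀ s, ∀ x ∈ Ω, lam • x + (1 - lam) • p s ∈ Ω) (ω : ℕ → ι) : codeMap lam p ω ∈ Ω := by
  obtain ⟨x, hx⟩ := hne
  exact hΩ.isClosed.mem_of_tendsto (tendsto_blockMap h0 h1 ω x)
    (Eventually.of_forall fun n => blockMap_mem hmaps ω n hx)

lemma exists_codeMap_eq (h0 : 0 < lam) (h1 : lam < 1) (hΩ : IsCompact Ω)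
    (hcover : ∀ x ∈ Ω, ∃ s, ∃ y ∈ Ω, lam • y + (1 - lam) • p s = x) {x : E} (hx : x ∈ Ω) :
    ∃ ω, codeMap lam p ω = x := by
  have : Nonempty ι := ⟨(hcover x hx).choose⟩
  choose! s y hy hxy using hcover
  set orbit : ℕ → E := fun n => y^[n] x with horbit
  have horb : ∀ n, orbit n ∈ Ω := by
    intro n
    induction n with
    | zero => exact hx
    | succ n ih =>
      rw [horbit]
      simp only [Function.iterate_succ_apply']
      exact hy _ ih
  set ω : ℕ → ι := fun n => s (orbit n) with hω
  have hblock : ∀ n, blockMap lam p ω n (orbit n) = x := by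
    intro n
    induction n with
    | zero => simp [blockMap, horbit]
    | succ n ih =>
      rw [blockMap_add, blockMap_one]
      have h := hxy _ (horb n)
      have h2 : orbit (n + 1) = y (orbit n) := Function.iterate_succ_apply' _ _ _
      rw [h2]
      simp only [add_zero, hω]
      rw [h, ih]
  obtain ⟨B, hB⟩ := exists_dist_bound hΩ
  refine ⟨ω, tendsto_nhds_unique (tendsto_blockMap h0 h1 ω x) ?_⟩
  rw [tendsto_iff_norm_sub_tendsto_zero]
  refine squeeze_zero (fun _ => norm_nonneg _) (fun n => ?_)
    (by simpa using (tendsto_pow_atTop_nhds_zero_of_lt_one h0.le h1).mul_const B)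
  have hdiff := blockMap_sub (lam := lam) (p := p) ω n x (orbit n)
  rw [hblock n] at hdiff
  rw [hdiff, norm_smul, Real.norm_of_nonneg (by positivity)]
  gcongr
  exact hB _ hx _ (horb n)


lemma codeMap_appendAt (h0 : 0 < lam) (h1 : lam < 1) (ω : ℕ → ι) (n : ℕ) (τ : ℕ → ι) :
    codeMap lam p (appendAt ω n τ) = blockMap lam p ω n (codeMap lam p τ) := by
  rw [codeMap_eq_blockMap h0 h1 _ n, appendAt_add, blockMap_congr (appendAt_mem_cylinder ω n τ)]

lemma exists_cylinder_subset {ι : Type*} [TopologicalSpace ι] [DiscreteTopology ι] {τ : ℕ → ι}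
    {U : Set (ℕ → ι)} (hU : U ∈ 𝓝 τ) : ∃ n, PiNat.cylinder (E := fun _ => ι) τ n ⊆ U := by
  obtain ⟨_, ⟨x, n, rfl⟩, hx, hs⟩ :=
    (PiNat.isTopologicalBasis_cylinders fun _ : ℕ => ι).mem_nhds_iff.1 hU
  exact ⟨n, by rwa [PiNat.mem_cylinder_iff_eq.1 hx]⟩

lemma exists_uniform_depth [TopologicalSpace ι] [DiscreteTopology ι] (h0 : 0 < lam) (h1 : lam < 1)
    (hΩ : IsCompact Ω)
    (hcover : ∀ x ∈ Ω, ∃ s, ∃ y ∈ Ω, lam • y + (1 - lam) • p s = x)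
    {O : Set E} (hO : IsOpen O) (hOne : O.Nonempty) {K : Set E} (hK : IsCompact K)
    (hKint : ∀ D ∈ K, ∃ b ∈ interior Ω, b + D ∈ Ω) :
    ∃ L, ∀ D ∈ K, ∃ τ ν : ℕ → ι, ∃ N, ∀ τ' ∈ PiNat.cylinder (E := fun _ => ι) τ L,
      codeMap lam p τ' + D ∈ blockMap lam p ν N '' O := by
  refine hK.induction_on (p := fun S => ∃ L, ∀ D ∈ S, ∃ τ ν : ℕ → ι, ∃ N,
    ∀ τ' ∈ PiNat.cylinder (E := fun _ => ι) τ L,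
      codeMap lam p τ' + D ∈ blockMap lam p ν N '' O) ⟨0, by simp⟩ ?_ ?_ ?_
  · rintro s t hst ⟨L, hL⟩
    exact ⟨L, fun D hD => hL D (hst hD)⟩
  · rintro s t ⟨L₁, h₁⟩ ⟨L₂, h₂⟩
    refine ⟨max L₁ L₂, ?_⟩
    rintro D (hD | hD)
    · obtain ⟨τ, ν, N, h⟩ := h₁ D hD
      exact ⟨τ, ν, N, fun τ' hτ' => h τ' (PiNat.cylinder_anti _ (le_max_left _ _) hτ')⟩
    · obtain ⟨τ, ν, N, h⟩ := h₂ D hD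
      exact ⟨τ, ν, N, fun τ' hτ' => h τ' (PiNat.cylinder_anti _ (le_max_right _ _) hτ')⟩
  · intro D hD
    obtain ⟨b, hb, hbD⟩ := hKint D hD
    obtain ⟨ν, hν⟩ := exists_codeMap_eq h0 h1 hΩ hcover hbD
    obtain ⟨o, ho⟩ := hOne
    have hlim : Tendsto (fun n => blockMap lam p ν n o - D) atTop (𝓝 b) := by
      simpa [hν] using (tendsto_blockMap (p := p) h0 h1 ν o).sub_const D
    obtain ⟨N, hN⟩ := (hlim.eventually_mem (mem_interior_iff_mem_nhds.1 hb)).exists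
    obtain ⟨τ, hτ⟩ := exists_codeMap_eq h0 h1 hΩ hcover hN
    have hcont : Continuous fun q : (ℕ → ι) × E => codeMap lam p q.1 + q.2 :=
      ((continuous_codeMap h0 h1).comp continuous_fst).add continuous_snd
    have hmem : (fun q : (ℕ → ι) × E => codeMap lam p q.1 + q.2) ⁻¹' (blockMap lam p ν N '' O) ∈
        𝓝 (τ, D) :=
      ((isOpen_blockMap_image h0 ν N hO).preimage hcont).mem_nhds ⟨o, ho, by simp [hτ]⟩
    obtain ⟨U, hU, V, hV, hUV⟩ := mem_nhds_prod_iff.1 hmem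
    obtain ⟨L, hL⟩ := exists_cylinder_subset hU
    exact ⟨V, mem_nhdsWithin_of_mem_nhds hV, L, fun D' hD' =>
      ⟨τ, ν, N, fun τ' hτ' => hUV (Set.mk_mem_prod (hL hτ') hD')⟩⟩

/-- The points with an address that begins with the first `n` letters of `w`, and for which no
address beginning this way passes through the branching set `O` at or after time `n`. -/
def nonBranching (lam : ℝ) (p : ι → E) (Ω O : Set E) (w : ℕ → ι) (n : ℕ) : Set E :=
  blockMap lam p w n '' Ω \
    ⋃ w' ∈ PiNat.cylinder (E := fun _ => ι) w n, ⋃ N ≥ n, blockMap lam p w' N '' O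

omit [Finite ι] [CompleteSpace E] in
lemma nonBranching_congr {Ω O : Set E} {w v : ℕ → ι} {n : ℕ}
    (h : v ∈ PiNat.cylinder (E := fun _ => ι) w n) :
    nonBranching lam p Ω O v n = nonBranching lam p Ω O w n := by
  unfold nonBranching
  rw [blockMap_congr h, PiNat.mem_cylinder_iff_eq.1 h]

omit [Finite ι] [CompleteSpace E] in
lemma measurableSet_nonBranching [MeasurableSpace E] [BorelSpace E] (h0 : 0 < lam)
    (hΩ : IsCompact Ω) {O : Set E} (hO : IsOpen O) (w : ℕ → ι) (n : ℕ) :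
    MeasurableSet (nonBranching lam p Ω O w n) :=
  (hΩ.image (continuous_blockMap w n)).measurableSet.diff
    (isOpen_biUnion fun w' _ => isOpen_biUnion fun N _ =>
      isOpen_blockMap_image h0 w' N hO).measurableSet

lemma exists_porosity_depth [TopologicalSpace ι] [DiscreteTopology ι] (h0 : 0 < lam) (h1 : lam < 1)
    (hΩ : IsCompact Ω) (hint : (interior Ω).Nonempty)
    (hmaps : ∀ s, ∀ x ∈ Ω, lam • x + (1 - lam) • p s ∈ Ω)
    (hcover : ∀ x ∈ Ω, ∃ s, ∃ y ∈ Ω, lam • y + (1 - lam) • p s = x)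
    {O : Set E} (hO : IsOpen O) (hOne : O.Nonempty) :
    ∃ L, ∀ (w : ℕ → ι) (n₀ : ℕ) (ω : ℕ → ι), ∀ n ≥ n₀,
      ∃ η ∈ PiNat.cylinder (E := fun _ => ι) ω n,
        ∀ ζ ∈ PiNat.cylinder (E := fun _ => ι) η (n + L),
          codeMap lam p ζ ∉ nonBranching lam p Ω O w n₀ := by
  have hne : Ω.Nonempty := hint.mono interior_subset
  obtain ⟨z, hz⟩ := hint
  obtain ⟨σ, hσ⟩ := exists_codeMap_eq h0 h1 hΩ hcover (interior_subset hz)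
  obtain ⟨M, hM⟩ := exists_cylinder_subset
    ((isOpen_interior.preimage (continuous_codeMap (p := p) h0 h1)).mem_nhds
      (show codeMap lam p σ ∈ interior Ω by rwa [hσ]))
  have hσM : ∀ x ∈ Ω, blockMap lam p σ M x ∈ interior Ω := by
    intro x hx
    obtain ⟨α, rfl⟩ := exists_codeMap_eq h0 h1 hΩ hcover hx
    rw [← codeMap_appendAt h0 h1]
    exact hM (appendAt_mem_cylinder σ M α)
  obtain ⟨L, hL⟩ := exists_uniform_depth h0 h1 hΩ hcover hO hOne
    (K := (fun q : E × E => q.1 - blockMap lam p σ M q.2) '' (Ω ×ˢ Ω))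
    ((hΩ.prod hΩ).image (continuous_fst.sub ((continuous_blockMap σ M).comp continuous_snd))) (by
      rintro _ ⟨⟨a, x⟩, ⟨ha, hx⟩, rfl⟩
      exact ⟨_, hσM x hx, by simpa using ha⟩)
  refine ⟨max M L, fun w n₀ ω n hn => ?_⟩
  by_cases hmeet : ∃ x ∈ Ω, blockMap lam p ω n (blockMap lam p σ M x) ∈ blockMap lam p w n₀ '' Ω
  · obtain ⟨x, hx, a', ha', hxa⟩ := hmeet
    obtain ⟨α, rfl⟩ := exists_codeMap_eq h0 h1 hΩ hcover ha'
    rw [← codeMap_appendAt h0 h1, codeMap_eq_blockMap h0 h1 _ n] at hxa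
    set w' := appendAt w n₀ α with hw'
    set a := codeMap lam p fun l => w' (n + l) with ha
    have haΩ : a ∈ Ω := codeMap_mem h0 h1 hΩ hne hmaps _
    have htrans : ∀ y, blockMap lam p ω n y =
        blockMap lam p w' n (y + (a - blockMap lam p σ M x)) := by
      intro y
      have e₁ := blockMap_sub (lam := lam) (p := p) ω n y (blockMap lam p σ M x)
      have e₂ := blockMap_sub (lam := lam) (p := p) w' n (y + (a - blockMap lam p σ M x)) a
      rw [hxa, show y + (a - blockMap lam p σ M x) - a = y - blockMap lam p σ M x by abel,
        ← e₁] at e₂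
      exact (sub_left_injective e₂).symm
    obtain ⟨τ, ν, N, hτ⟩ := hL _ ⟨(a, x), ⟨haΩ, hx⟩, rfl⟩
    refine ⟨appendAt ω n τ, appendAt_mem_cylinder ω n τ, fun ζ hζ hmem => hmem.2 ?_⟩
    obtain ⟨o, ho, hoeq⟩ := hτ _ (PiNat.cylinder_anti _ (le_max_right M L) (shift_mem_cylinder hζ))
    simp only [Set.mem_iUnion]
    refine ⟨appendAt w' n ν, fun l hl => ?_, n + N, by omega, o, ho, ?_⟩
    · simp [appendAt, hw', hl, hl.trans_le hn]
    · rw [blockMap_add, appendAt_add, blockMap_congr (appendAt_mem_cylinder w' n ν), hoeq, ← htrans,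
        codeMap_eq_blockMap h0 h1 ζ n, blockMap_congr (mem_cylinder_of_append hζ)]
  · refine ⟨appendAt ω n σ, appendAt_mem_cylinder ω n σ, fun ζ hζ hmem => hmeet ?_⟩
    refine ⟨codeMap lam p fun l => ζ (n + (M + l)), codeMap_mem h0 h1 hΩ hne hmaps _, ?_⟩
    have hζσ := PiNat.cylinder_anti _ (le_max_left M L) (shift_mem_cylinder hζ)
    rw [← blockMap_congr hζσ,
      ← codeMap_eq_blockMap h0 h1 (fun l => ζ (n + l)) M,
      ← blockMap_congr (mem_cylinder_of_append hζ), ← codeMap_eq_blockMap h0 h1 ζ n]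
    exact hmem.1

lemma continuum_le_mk_addresses {ι : Type} [Finite ι] [TopologicalSpace ι] [DiscreteTopology ι]
    {p : ι → E} (h0 : 0 < lam) (h1 : lam < 1) (hΩ : IsCompact Ω)
    (hmaps : ∀ s, ∀ x ∈ Ω, lam • x + (1 - lam) • p s ∈ Ω)
    (hcover : ∀ x ∈ Ω, ∃ s, ∃ y ∈ Ω, lam • y + (1 - lam) • p s = x)
    {O : Set E} {i k : ι} (hik : i ≠ k)
    (hOi : ∀ o ∈ O, ∃ y ∈ Ω, lam • y + (1 - lam) • p i = o)
    (hOk : ∀ o ∈ O, ∃ y ∈ Ω, lam • y + (1 - lam) • p k = o)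
    {x : E} (hx : x ∈ Ω) (hbranch : ∀ w n, x ∉ nonBranching lam p Ω O w n) :
    Cardinal.continuum ≤ Cardinal.mk {a : ℕ → ι // x = codeMap lam p a} := by
  have hclosed : IsClosed (codeMap lam p ⁻¹' {x}) :=
    isClosed_singleton.preimage (continuous_codeMap h0 h1)
  have hne : (codeMap lam p ⁻¹' {x}).Nonempty := exists_codeMap_eq h0 h1 hΩ hcover hx
  have hacc : Preperfect (codeMap lam p ⁻¹' {x}) := by
    intro a ha
    rw [accPt_iff_nhds]
    intro U hU
    obtain ⟨n, hn⟩ := exists_cylinder_subset hU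
    have hxa : x ∈ blockMap lam p a n '' Ω :=
      ⟨_, codeMap_mem h0 h1 hΩ ⟨x, hx⟩ hmaps _, (codeMap_eq_blockMap h0 h1 a n).symm.trans ha⟩
    have hxn := hbranch a n
    simp only [nonBranching, Set.mem_sdiff, hxa, true_and, not_not, Set.mem_iUnion] at hxn
    obtain ⟨w, hw, N, hN, o, ho, hox⟩ := hxn
    have key : ∀ s, (∃ y ∈ Ω, lam • y + (1 - lam) • p s = o) →
        ∃ ζ ∈ U ∩ codeMap lam p ⁻¹' {x}, ζ N = s := by
      rintro s ⟨y, hy, hyo⟩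
      obtain ⟨α, rfl⟩ := exists_codeMap_eq h0 h1 hΩ hcover hy
      refine ⟨appendAt w N (appendAt (fun _ => s) 1 α), ⟨hn fun l hl => ?_, ?_⟩, ?_⟩
      · rw [appendAt_mem_cylinder w N _ l (hl.trans_le hN), hw l hl]
      · rw [Set.mem_preimage, codeMap_appendAt h0 h1, codeMap_appendAt h0 h1, blockMap_one, hyo, hox,
          Set.mem_singleton_iff]
      · simp [appendAt]
    obtain ⟨ζ₁, h₁, e₁⟩ := key i (hOi o ho)
    obtain ⟨ζ₂, h₂, e₂⟩ := key k (hOk o ho)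
    by_cases h : ζ₁ = a
    · refine ⟨ζ₂, h₂, fun h' => hik ?_⟩
      rw [← e₁, ← e₂, h, h']
    · exact ⟨ζ₁, h₁, h⟩
  let _ : MetricSpace (ℕ → ι) := PiNat.metricSpace (E := fun _ => ι)
  have : CompleteSpace (ℕ → ι) := PiNat.completeSpace (E := fun _ => ι)
  obtain ⟨g, hg, -, hginj⟩ := Perfect.exists_nat_bool_injection ⟨hclosed, hacc⟩ hne
  have hle := Cardinal.mk_le_of_injective
    (f := fun b => (⟨g b, (hg ⟨b, rfl⟩ : codeMap lam p (g b) = x).symm⟩ :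
      {a : ℕ → ι // x = codeMap lam p a}))
    fun b c hbc => hginj (congrArg Subtype.val hbc)
  simpa using hle

end Coding

lemma measure_eq_zero_of_porous {m : ℕ} {p' : Fin m → ℝ} (hp'pos : ∀ s, 0 < p' s)
    {ρ : Measure (ℕ → Fin m)} [IsProbabilityMeasure ρ]
    (hρ : ∀ (n : ℕ) (w : Fin n → Fin m),
      ρ {ω | ∀ l : Fin n, ω l = w l} = ENNReal.ofReal (∏ l, p' (w l)))
    {A : Set (ℕ → Fin m)} {n₀ L : ℕ}
    (hA : ∀ ω, ∀ n ≥ n₀, ∃ η ∈ PiNat.cylinder (E := fun _ => Fin m) ω n,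
      ∀ ζ ∈ PiNat.cylinder (E := fun _ => Fin m) η (n + L), ζ ∉ A) :
    ρ A = 0 := by
  classical
  obtain ⟨q, hq, hqp⟩ : ∃ q > 0, ∀ s, q ≤ p' s := by
    rcases isEmpty_or_nonempty (Fin m) with h | h
    · exact ⟨1, one_pos, fun s => h.elim s⟩
    · obtain ⟨s, hs⟩ := Finite.exists_min p'
      exact ⟨p' s, hp'pos s, hs⟩
  set B : (n : ℕ) → (Fin n → Fin m) → Set (ℕ → Fin m) :=
    fun n t => {ω | ∀ l : Fin n, ω l = t l} with hB
  have hmeas : ∀ n t, MeasurableSet (B n t) := by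
    intro n t
    simp only [hB, Set.ofPred_forall]
    exact MeasurableSet.iInter fun l =>
      measurableSet_eq_fun (measurable_pi_apply _) measurable_const
  have hdisj : ∀ n, Pairwise (Function.onFun Disjoint (B n)) := by
    intro n s t hst
    refine Set.disjoint_left.2 fun ω hs ht => hst ?_
    funext l
    rw [← hs l, ht l]
  set T : (n : ℕ) → Finset (Fin n → Fin m) :=
    fun n => Finset.univ.filter fun t => (B n t ∩ A).Nonempty with hT
  have hcover : ∀ n, A ⊆ ⋃ t ∈ T n, B n t := by
    intro n ω hω
    have hmem : ω ∈ B n fun l => ω l := fun l => rfl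
    exact Set.mem_biUnion (by simpa [hT] using ⟨ω, hmem, hω⟩) hmem
  have hunion : ∀ n, ρ (⋃ t ∈ T n, B n t) = ∑ t ∈ T n, ρ (B n t) := fun n =>
    measure_biUnion_finset (fun s _ t _ hst => hdisj n hst) fun t _ => hmeas n t
  have hratio : ∀ (n : ℕ) (t : Fin n → Fin m) (η : ℕ → Fin m), η ∈ B n t →
      ENNReal.ofReal (q ^ L) * ρ (B n t) ≤ ρ (B (n + L) fun l => η l) := by
    intro n t η hη
    rw [hρ, hρ, ← ENNReal.ofReal_mul (by positivity), Fin.prod_univ_add, mul_comm]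
    refine ENNReal.ofReal_le_ofReal (mul_le_mul ?_ ?_ (by positivity)
      (Finset.prod_nonneg fun l _ => (hp'pos _).le))
    · refine le_of_eq (Finset.prod_congr rfl fun l _ => ?_)
      rw [← hη l]
      rfl
    · simpa using Finset.prod_le_prod (s := (Finset.univ : Finset (Fin L))) (f := fun _ => q)
        (fun _ _ => hq.le) fun l _ => hqp (η (n + l))
  set c := ENNReal.ofReal (q ^ L) with hc
  have hstep : ∀ n ≥ n₀, ρ (⋃ t ∈ T (n + L), B (n + L) t) ≤ (1 - c) * ρ (⋃ t ∈ T n, B n t) := by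
    intro n hn
    have hη : ∀ t : Fin n → Fin m, t ∈ T n → ∃ η ∈ B n t,
        ∀ ζ ∈ PiNat.cylinder (E := fun _ => Fin m) η (n + L), ζ ∉ A := by
      intro t ht
      obtain ⟨ω, hω, -⟩ := (Finset.mem_filter.1 ht).2
      obtain ⟨η, hη, h⟩ := hA ω n hn
      exact ⟨η, fun l => (hη l l.2).trans (hω l), h⟩
    have : Nonempty (ℕ → Fin m) := nonempty_of_isProbabilityMeasure ρ
    choose! η hηB hηA using hη
    have hsub : (⋃ t ∈ T (n + L), B (n + L) t) ⊆
        ⋃ t ∈ T n, B n t \ B (n + L) fun l => η t l := by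
      refine Set.iUnion₂_subset fun t ht ω hω => ?_
      obtain ⟨e, het, heA⟩ := (Finset.mem_filter.1 ht).2
      have hωe : ∀ l < n + L, ω l = e l := fun l hl =>
        (hω ⟨l, hl⟩).trans (het ⟨l, hl⟩).symm
      refine Set.mem_biUnion (x := fun l : Fin n => ω l) ?_ ⟨fun l => rfl, fun h => ?_⟩
      · simp only [hT, Finset.coe_filter, Finset.mem_univ, true_and, Set.mem_ofPred_eq]
        exact ⟨e, fun l => (hωe l (by omega)).symm, heA⟩
      · refine hηA (fun l : Fin n => ω l) ?_ e (fun l hl => ?_) heA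
        · simp only [hT, Finset.mem_filter, Finset.mem_univ, true_and]
          exact ⟨e, fun l => (hωe l (by omega)).symm, heA⟩
        · rw [← hωe l hl]
          exact h ⟨l, hl⟩
    calc ρ (⋃ t ∈ T (n + L), B (n + L) t)
        ≤ ρ (⋃ t ∈ T n, B n t \ B (n + L) fun l => η t l) := measure_mono hsub
      _ ≤ ∑ t ∈ T n, ρ (B n t \ B (n + L) fun l => η t l) := measure_biUnion_finset_le _ _
      _ ≤ ∑ t ∈ T n, (1 - c) * ρ (B n t) := by
        refine Finset.sum_le_sum fun t ht => ?_
        have hss : (B (n + L) fun l => η t l) ⊆ B n t := fun ω hω l =>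
          (hω (Fin.castAdd L l)).trans (hηB t ht l)
        rw [measure_sdiff hss (hmeas _ _).nullMeasurableSet (measure_ne_top _ _),
          ENNReal.sub_mul fun _ _ => measure_ne_top _ _, one_mul]
        exact tsub_le_tsub_left (hratio n t _ (hηB t ht)) _
      _ = (1 - c) * ρ (⋃ t ∈ T n, B n t) := by rw [hunion, Finset.mul_sum]
  have hpow : ∀ N : ℕ, ρ (⋃ t ∈ T (n₀ + N * L), B (n₀ + N * L) t) ≤ (1 - c) ^ N := by
    intro N
    induction N with
    | zero => simpa using prob_le_one
    | succ N ih =>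
      rw [add_mul, one_mul, ← add_assoc, pow_succ']
      exact (hstep _ (by omega)).trans (by gcongr)
  have hlt : 1 - c < 1 := ENNReal.sub_lt_self (by simp) (by simp)
    (by simpa [hc] using pow_pos hq L)
  exact le_antisymm (ge_of_tendsto' (ENNReal.tendsto_pow_atTop_nhds_zero_of_lt_one hlt)
    fun N => (measure_mono (hcover _)).trans (hpow N)) zero_le

/-- Under the assumptions of the main theorem, the natural self-similar
measure `μ = π_*ρ` (push-forward of a Bernoulli measure `ρ` on the symbol
space by the coding map `π`) gives measure zero to the set of points having
fewer than a continuum of addresses: `μ`-a.e. point has `2^ℵ₀` addresses. -/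
theorem stmt16 (d m : ℕ) (hd : 1 ≤ d) (hm : 2 ≤ m)
    (p : Fin m → EuclideanSpace ℝ (Fin d)) (hp : Function.Injective p)
    (lam : ℝ) (h0 : 0 < lam) (h1 : lam < 1)
    (f : Fin m → EuclideanSpace ℝ (Fin d) → EuclideanSpace ℝ (Fin d))
    (hf : ∀ j x, f j x = lam • x + (1 - lam) • p j)
    (Ω : Set (EuclideanSpace ℝ (Fin d))) (hΩ : Ω = convexHull ℝ (Set.range p))
    (hint : (interior Ω).Nonempty)
    (hnoholes : Ω = ⋃ j, f j '' Ω)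
    (i k : Fin m) (hik : i ≠ k) (j : Fin m)
    (hvertex : p j ∈ Set.extremePoints ℝ Ω)
    (hover : f k (p j) ∈ interior (f i '' Ω))
    (p' : Fin m → ℝ) (hp'pos : ∀ s, 0 < p' s) (hp'sum : ∑ s, p' s = 1)
    (ρ : Measure (ℕ → Fin m)) [IsProbabilityMeasure ρ]
    (hρ : ∀ (n : ℕ) (w : Fin n → Fin m),
      ρ {ω | ∀ l : Fin n, ω l = w l} = ENNReal.ofReal (∏ l, p' (w l)))
    (π : (ℕ → Fin m) → EuclideanSpace ℝ (Fin d))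
    (hπ : ∀ ω, π ω = (lam⁻¹ - 1) • ∑' n : ℕ, lam ^ (n + 1) • p (ω n))
    (μ : Measure (EuclideanSpace ℝ (Fin d))) (hμ : μ = ρ.map π) :
    μ {x : EuclideanSpace ℝ (Fin d) |
      Cardinal.mk {a : ℕ → Fin m //
        x = (lam⁻¹ - 1) • ∑' n : ℕ, lam ^ (n + 1) • p (a n)} < Cardinal.continuum} = 0 := by
  classical
  have hΩc : IsCompact Ω := by
    rw [hΩ]
    exact (Set.finite_range p).isCompact_convexHull ℝ
  have hΩconv : Convex ℝ Ω := by
    rw [hΩ]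
    exact convex_convexHull ℝ _
  have hmaps : ∀ s, ∀ x ∈ Ω, lam • x + (1 - lam) • p s ∈ Ω := by
    intro s x hx
    rw [← hf, hnoholes]
    exact Set.mem_iUnion_of_mem s ⟨x, hx, rfl⟩
  have hcover : ∀ x ∈ Ω, ∃ s, ∃ y ∈ Ω, lam • y + (1 - lam) • p s = x := by
    intro x hx
    rw [hnoholes] at hx
    obtain ⟨s, y, hy, hyx⟩ := Set.mem_iUnion.1 hx
    exact ⟨s, y, hy, by rw [← hf, hyx]⟩
  have hne : Ω.Nonempty := hint.mono interior_subset
  have hπcode : π = codeMap lam p := funext hπ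
  obtain ⟨O, hOdef⟩ : ∃ O, O = interior (f i '' Ω) ∩ interior (f k '' Ω) := ⟨_, rfl⟩
  have hO : IsOpen O := hOdef ▸ isOpen_interior.inter isOpen_interior
  have hOmem : ∀ s, ∀ o ∈ interior (f s '' Ω), ∃ y ∈ Ω, lam • y + (1 - lam) • p s = o := by
    intro s o ho
    obtain ⟨y, hy, hyo⟩ := interior_subset ho
    exact ⟨y, hy, by rw [← hf, hyo]⟩
  have hOne : O.Nonempty := by
    have hcont : Continuous (f k) := by
      rw [funext (hf k)]
      fun_prop
    have hcl : p j ∈ closure (interior Ω) := by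
      rw [hΩconv.closure_interior_eq_closure_of_nonempty_interior hint]
      exact subset_closure hvertex.1
    obtain ⟨z, hz, hzΩ⟩ := mem_closure_iff.1 hcl _ (isOpen_interior.preimage hcont) hover
    rw [hOdef]
    refine ⟨f k z, hz, interior_maximal (Set.image_mono interior_subset) ?_ ⟨z, hzΩ, rfl⟩⟩
    have hblock : f k = blockMap lam p (fun _ => k) 1 := by
      funext x
      rw [blockMap_one, hf]
    rw [hblock]
    exact isOpen_blockMap_image h0 _ _ isOpen_interior
  obtain ⟨L, hL⟩ := exists_porosity_depth h0 h1 hΩc hint hmaps hcover hO hOne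
  obtain ⟨word, hword⟩ : ∃ word : (n : ℕ) → (Fin n → Fin m) → ℕ → Fin m,
      ∀ n w, w ∈ PiNat.cylinder (E := fun _ => Fin m) (word n fun l => w l) n :=
    ⟨fun n v l => if h : l < n then v ⟨l, h⟩ else i, fun n w l hl => by simp [hl]⟩
  have hmeas : Measurable π := by
    rw [hπcode]
    exact (continuous_codeMap h0 h1).measurable
  have hnull : ∀ n v, μ (nonBranching lam p Ω O (word n v) n) = 0 := by
    intro n v
    rw [hμ, Measure.map_apply hmeas (measurableSet_nonBranching h0 hΩc hO _ _), hπcode]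
    exact measure_eq_zero_of_porous hp'pos hρ (hL (word n v) n)
  have hΩnull : μ Ωᶜ = 0 := by
    rw [hμ, Measure.map_apply hmeas hΩc.measurableSet.compl]
    convert measure_empty (μ := ρ)
    refine Set.eq_empty_of_forall_notMem fun ω hω => hω ?_
    rw [hπcode]
    exact codeMap_mem h0 h1 hΩc hne hmaps ω
  refine measure_mono_null (t := Ωᶜ ∪ ⋃ n, ⋃ v, nonBranching lam p Ω O (word n v) n) ?_
    (measure_union_null hΩnull
      (measure_iUnion_null fun n => measure_iUnion_null fun v => hnull n v))
  intro x hx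
  by_contra hcon
  simp only [Set.mem_union, Set.mem_compl_iff, Set.mem_iUnion, not_or, not_not, not_exists] at hcon
  have hmk := continuum_le_mk_addresses (O := O) h0 h1 hΩc hmaps hcover hik
    (fun o ho => hOmem i o (hOdef ▸ ho).1) (fun o ho => hOmem k o (hOdef ▸ ho).2) hcon.1 (by
      intro w n
      rw [nonBranching_congr (hword n w)]
      exact hcon.2 n _)
  exact hmk.not_gt hx
end

section
/- Let p_0, p_1, p_2 be three affinely independent points in ℝ² (vertices of a triangle), λ ∈ (0,1), and f_j(x) = λx + (1−λ)p_j for j = 0,1,2. Let λ_0 ≈ 0.68233 be the unique positive real root of x³ + x = 1. If λ < λ_0, then the set of uniqueness is nonempty: there exists a point x of the attractor S_λ having exactly one address. -/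
/-- The discounted number of occurrences of the digit `j` in the sequence `i`. -/
noncomputable def digitSum (lam : ℝ) (i : ℕ → Fin 3) (j : Fin 3) : ℝ :=
  ∑' n : ℕ, lam ^ n * if i n = j then 1 else 0

theorem summable_digitSum {lam : ℝ} (h0 : 0 < lam) (h1 : lam < 1) (i : ℕ → Fin 3) (j : Fin 3) :
    Summable fun n : ℕ => lam ^ n * (if i n = j then 1 else 0 : ℝ) := by
  refine Summable.of_nonneg_of_le (fun n => ?_) (fun n => ?_)
    (summable_geometric_of_lt_one h0.le h1)
  · positivity
  · have := pow_pos h0 n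
    split_ifs <;> linarith

theorem digitSum_nonneg {lam : ℝ} (h0 : 0 < lam) (i : ℕ → Fin 3) (j : Fin 3) :
    0 ≤ digitSum lam i j :=
  tsum_nonneg fun n => by positivity

theorem digitSum_eq_head_add_tail {lam : ℝ} (h0 : 0 < lam) (h1 : lam < 1) (i : ℕ → Fin 3)
    (j : Fin 3) :
    digitSum lam i j =
      (if i 0 = j then 1 else 0) + lam * digitSum lam (fun n => i (n + 1)) j := by
  unfold digitSum
  rw [(summable_digitSum h0 h1 i j).tsum_eq_zero_add, ← tsum_mul_left]
  simp only [pow_zero, one_mul, pow_succ']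
  congr 1
  exact tsum_congr fun n => by ring

theorem sum_digitSum {lam : ℝ} (h0 : 0 < lam) (h1 : lam < 1) (i : ℕ → Fin 3) :
    ∑ j, digitSum lam i j = (1 - lam)⁻¹ := by
  unfold digitSum
  rw [← Summable.tsum_finsetSum fun j _ => summable_digitSum h0 h1 i j,
    ← tsum_geometric_of_lt_one h0.le h1]
  exact tsum_congr fun n => by simp

theorem tsum_smul_eq_sum_digitSum {E : Type*} [NormedAddCommGroup E] [NormedSpace ℝ E]
    (p : Fin 3 → E) {lam : ℝ} (h0 : 0 < lam) (h1 : lam < 1) (i : ℕ → Fin 3) :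
    ∑' n : ℕ, lam ^ (n + 1) • p (i n) = lam • ∑ j, digitSum lam i j • p j := by
  have h := hasSum_sum (s := Finset.univ) fun j _ =>
    ((summable_digitSum h0 h1 i j).hasSum.smul_const (p j))
  unfold digitSum
  rw [← (h.const_smul lam).tsum_eq]
  refine tsum_congr fun n => ?_
  simp [pow_succ', smul_smul]

theorem digitSum_periodic_lt_one {lam : ℝ} (h0 : 0 < lam) (h : lam ^ 3 + lam < 1)
    {s j : Fin 3} (hj : s ≠ j) : digitSum lam (fun n => s + n • (1 : Fin 3)) j < 1 := by
  have h3 : 0 < lam ^ 3 := by positivity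
  have h1 : lam < 1 := by linarith
  have hper : (fun n : ℕ => s + (n + 1 + 1 + 1) • (1 : Fin 3)) = fun n : ℕ => s + n • (1 : Fin 3) := by
    funext n
    simp only [succ_nsmul]
    generalize n • (1 : Fin 3) = t
    clear hj
    revert s t
    decide
  have e := digitSum_eq_head_add_tail h0 h1 (fun n : ℕ => s + n • (1 : Fin 3)) j
  rw [digitSum_eq_head_add_tail h0 h1 (fun n : ℕ => s + (n + 1) • (1 : Fin 3)) j,
    digitSum_eq_head_add_tail h0 h1 (fun n : ℕ => s + (n + 1 + 1) • (1 : Fin 3)) j, hper] at e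
  have hcases : s + 1 ≠ j ∨ s + 1 + 1 ≠ j := by
    clear e hper hj
    revert s j
    decide
  have hs : s + (1 + 1) = s + 1 + 1 := (add_assoc s 1 1).symm
  simp only [succ_nsmul, zero_nsmul, add_zero, zero_add, hj, if_false, hs] at e
  generalize digitSum lam (fun n => s + n • (1 : Fin 3)) j = T at e ⊢
  have hT : (1 - lam ^ 3) * T ≤ lam := by
    rcases hcases with hc | hc <;> simp only [hc, if_false] at e <;> split_ifs at e <;> nlinarith
  by_contra! hge
  nlinarith

theorem eq_periodic_of_digitSum_eq {lam : ℝ} (h0 : 0 < lam) (h : lam ^ 3 + lam < 1) (n : ℕ) :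
    ∀ (s : Fin 3) (i : ℕ → Fin 3),
      (∀ j, digitSum lam i j = digitSum lam (fun m => s + m • (1 : Fin 3)) j) →
      i n = s + n • (1 : Fin 3) := by
  have h1 : lam < 1 := by
    have : 0 < lam ^ 3 := by positivity
    linarith
  have head (s : Fin 3) (i : ℕ → Fin 3)
      (hi : ∀ j, digitSum lam i j = digitSum lam (fun m => s + m • (1 : Fin 3)) j) : i 0 = s := by
    by_contra hne
    have hlt := digitSum_periodic_lt_one h0 h (Ne.symm hne)
    rw [← hi, digitSum_eq_head_add_tail h0 h1, if_pos rfl] at hlt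
    have := mul_nonneg h0.le (digitSum_nonneg h0 (fun n => i (n + 1)) (i 0))
    linarith
  induction n with
  | zero => simpa using head
  | succ n ih =>
    intro s i hi
    have key := ih (s + 1) (fun m => i (m + 1)) fun j => by
      have e := hi j
      rw [digitSum_eq_head_add_tail h0 h1 i,
        digitSum_eq_head_add_tail h0 h1 (fun m : ℕ => s + m • (1 : Fin 3)), head s i hi] at e
      simp only [zero_nsmul, add_zero] at e
      have e' := mul_left_cancel₀ h0.ne' (add_left_cancel e)
      rw [e']
      congr 1
      funext m
      rw [succ_nsmul', add_assoc]
    rw [key, succ_nsmul', add_assoc]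

theorem digitSum_eq_of_sum_smul_eq {E : Type*} [NormedAddCommGroup E] [NormedSpace ℝ E]
    {p : Fin 3 → E} (hp : AffineIndependent ℝ p) {lam : ℝ} (h0 : 0 < lam) (h1 : lam < 1)
    {i i' : ℕ → Fin 3}
    (h : ∑ j, digitSum lam i j • p j = ∑ j, digitSum lam i' j • p j) (j : Fin 3) :
    digitSum lam i j = digitSum lam i' j := by
  refine sub_eq_zero.mp (affineIndependent_iff.mp hp Finset.univ
    (fun j => digitSum lam i j - digitSum lam i' j) ?_ ?_ j (Finset.mem_univ j))
  · rw [Finset.sum_sub_distrib, sum_digitSum h0 h1, sum_digitSum h0 h1, sub_self]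
  · simp only [sub_smul, Finset.sum_sub_distrib, h, sub_self]


/-- Triangular case: let `λ_0` be the unique positive root of `x³ + x = 1`.
If `λ < λ_0`, the set of uniqueness is nonempty: some point of the attractor
has exactly one address. -/
theorem stmt17 (p : Fin 3 → EuclideanSpace ℝ (Fin 2)) (hp : AffineIndependent ℝ p)
    (lam0 : ℝ) (hlam0pos : 0 < lam0) (hroot : lam0 ^ 3 + lam0 = 1)
    (lam : ℝ) (h0 : 0 < lam) (h1 : lam < lam0) :
    ∃ x : EuclideanSpace ℝ (Fin 2),
      ∃! i : ℕ → Fin 3, x = (lam⁻¹ - 1) • ∑' n : ℕ, lam ^ (n + 1) • p (i n) := by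
  have hlam : lam ^ 3 + lam < 1 := by
    have : lam ^ 3 < lam0 ^ 3 := pow_lt_pow_left₀ h1 h0.le (by norm_num)
    linarith
  have hlt : lam < 1 := by
    have : 0 < lam ^ 3 := by positivity
    linarith
  have hne : lam⁻¹ - 1 ≠ 0 := (sub_pos.mpr ((one_lt_inv₀ h0).mpr hlt)).ne'
  refine ⟨_, fun n => 0 + n • (1 : Fin 3), rfl, fun i hi => funext fun n => ?_⟩
  have e := smul_right_injective _ hne hi
  rw [tsum_smul_eq_sum_digitSum p h0 hlt, tsum_smul_eq_sum_digitSum p h0 hlt] at e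
  exact eq_periodic_of_digitSum_eq h0 hlam n 0 i
    (digitSum_eq_of_sum_smul_eq hp h0 hlt (smul_right_injective _ h0.ne' e).symm)
end

section
/- Let p_0, p_1, p_2 be three affinely independent points in ℝ², λ ∈ (0,1), f_j(x) = λx + (1−λ)p_j, and let λ_0 be the unique positive real root of x³ + x = 1. If λ ∈ (λ_0, 1), then every point x of the attractor S_λ other than the vertices p_0, p_1, p_2 has 2^ℵ₀ distinct addresses, i.e., the set of sequences (i_n) ∈ {0,1,2}^ℕ with x = (λ⁻¹ − 1)·∑_{n=1}^∞ λ^n p_{i_n} has the cardinality of the continuum. -/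
/-- Rescaled barycentric coordinates of a point of the triangle other than the vertices. -/
def IsNonvertex (lam : ℝ) (y : Fin 3 → ℝ) : Prop :=
  (∀ j, 0 ≤ y j) ∧ ∑ j, y j = (1 - lam)⁻¹ ∧ ∀ j, y j < (1 - lam)⁻¹

/-- The point `z` is the image of `y` under the inverse of the `d`-th contraction. -/
def IsStep (lam : ℝ) (y : Fin 3 → ℝ) (d : Fin 3) (z : Fin 3 → ℝ) : Prop :=
  ∀ j, y j = lam * z j + if d = j then 1 else 0

/-- The addresses of `y` whose orbits avoid the vertices of the triangle. -/
def orbitAddresses (lam : ℝ) (y : Fin 3 → ℝ) : Set (ℕ → Fin 3) :=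
  {i | ∃ r : ℕ → Fin 3 → ℝ, r 0 = y ∧
    ∀ n, IsNonvertex lam (r n) ∧ IsStep lam (r n) (i n) (r (n + 1))}

lemma two_thirds_lt {lam : ℝ} (h : 1 < lam ^ 3 + lam) : 2 / 3 < lam := by
  by_contra! hle
  nlinarith [sq_nonneg lam, sq_nonneg (lam + 1 / 3), sq_nonneg (lam - 2 / 3)]

lemma three_lt_inv {lam : ℝ} (h : 1 < lam ^ 3 + lam) (h1 : lam < 1) : 3 < (1 - lam)⁻¹ := by
  rw [lt_inv_comm₀ (by norm_num) (by linarith)]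
  linarith [two_thirds_lt h]

lemma inv_one_sub_sub_one {lam : ℝ} (h1 : lam < 1) :
    (1 - lam)⁻¹ - 1 = lam * (1 - lam)⁻¹ := by
  have : 1 - lam ≠ 0 := by linarith
  field_simp
  ring

lemma Fin.exists_third {j k : Fin 3} (hjk : j ≠ k) :
    ∃ l, l ≠ j ∧ l ≠ k ∧ (∀ m, m = j ∨ m = k ∨ m = l) ∧
      ∀ f : Fin 3 → ℝ, ∑ m, f m = f j + f k + f l := by
  have key : ∀ j k : Fin 3, j ≠ k → ∃ l, l ≠ j ∧ l ≠ k ∧ (∀ m, m = j ∨ m = k ∨ m = l) := by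
    decide
  obtain ⟨l, hlj, hlk, hm⟩ := key j k hjk
  refine ⟨l, hlj, hlk, hm, fun f => ?_⟩
  have huniv : (Finset.univ : Finset (Fin 3)) = {j, k, l} := by
    ext m
    simpa using hm m
  rw [huniv, Finset.sum_insert (by simp [hjk, hlj.symm]), Finset.sum_insert (by simp [hlk.symm]),
    Finset.sum_singleton, add_assoc]

lemma IsNonvertex.exists_step {lam : ℝ} (h : 1 < lam ^ 3 + lam) (h1 : lam < 1)
    {y : Fin 3 → ℝ} (hy : IsNonvertex lam y) {d : Fin 3} (hd : 1 ≤ y d)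
    (hlt : ∀ k, k ≠ d → y k < (1 - lam)⁻¹ - 1) :
    ∃ z, IsNonvertex lam z ∧ IsStep lam y d z := by
  have hpos : 0 < lam := by linarith [two_thirds_lt h]
  obtain ⟨hnn, hsum, hltM⟩ := hy
  refine ⟨fun j => (y j - if d = j then 1 else 0) / lam, ⟨fun j => ?_, ?_, fun j => ?_⟩,
    fun j => ?_⟩
  · apply div_nonneg _ hpos.le
    split_ifs with hj
    · subst hj; linarith
    · linarith [hnn j]
  · rw [← Finset.sum_div, Finset.sum_sub_distrib, hsum, div_eq_iff hpos.ne',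
      Finset.sum_ite_eq Finset.univ d, if_pos (Finset.mem_univ _), inv_one_sub_sub_one h1, mul_comm]
  · rw [div_lt_iff₀ hpos, mul_comm, ← inv_one_sub_sub_one h1]
    split_ifs with hj
    · linarith [hltM j]
    · linarith [hlt j (Ne.symm hj)]
  · field_simp
    ring

lemma IsNonvertex.exists_one_le {lam : ℝ} (h : 1 < lam ^ 3 + lam) (h1 : lam < 1)
    {y : Fin 3 → ℝ} (hy : IsNonvertex lam y) : ∃ d, 1 ≤ y d := by
  by_contra! hlt
  have hs := hy.2.1
  rw [Fin.sum_univ_three] at hs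
  linarith [three_lt_inv h h1, hlt 0, hlt 1, hlt 2]

lemma cons_mem_orbitAddresses {lam : ℝ} {y z : Fin 3 → ℝ} {d : Fin 3} {i : ℕ → Fin 3}
    (hy : IsNonvertex lam y) (hs : IsStep lam y d z) (hi : i ∈ orbitAddresses lam z) :
    (Stream'.cons d i : ℕ → Fin 3) ∈ orbitAddresses lam y := by
  obtain ⟨r, hr0, hr⟩ := hi
  refine ⟨Stream'.cons y r, rfl, fun n => ?_⟩
  cases n with
  | zero =>
    refine ⟨hy, ?_⟩
    change IsStep lam y d (r 0)
    rwa [hr0]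
  | succ n => exact hr n

lemma Stream'.cons_ne_cons {α : Type*} {d e : α} {i i' : ℕ → α} (h : d ≠ e ∨ i ≠ i') :
    (Stream'.cons d i : ℕ → α) ≠ Stream'.cons e i' := by
  intro he
  rcases h with h | h
  · exact h (congrFun he 0)
  · exact h (funext fun n => congrFun he (n + 1))

lemma nontrivial_of_step {lam : ℝ} {y z : Fin 3 → ℝ} {d : Fin 3} (hy : IsNonvertex lam y)
    (hs : IsStep lam y d z) (hz : (orbitAddresses lam z).Nontrivial) :
    (orbitAddresses lam y).Nontrivial := by
  obtain ⟨i, hi, i', hi', hne⟩ := hz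
  exact ⟨_, cons_mem_orbitAddresses hy hs hi, _, cons_mem_orbitAddresses hy hs hi',
    Stream'.cons_ne_cons (Or.inr hne)⟩

/-- From a nonvertex point one can always step to another nonvertex point. -/
lemma IsNonvertex.exists_digit {lam : ℝ} (h : 1 < lam ^ 3 + lam) (h1 : lam < 1)
    {y : Fin 3 → ℝ} (hy : IsNonvertex lam y) :
    ∃ d z, IsNonvertex lam z ∧ IsStep lam y d z := by
  have h3 := three_lt_inv h h1
  obtain ⟨d, hd⟩ := hy.exists_one_le h h1
  by_cases hlt : ∀ k, k ≠ d → y k < (1 - lam)⁻¹ - 1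
  · exact ⟨d, hy.exists_step h h1 hd hlt⟩
  · push Not at hlt
    obtain ⟨k, hkd, hk⟩ := hlt
    obtain ⟨l, hld, hlk, hm, hs⟩ := Fin.exists_third hkd
    have hsum := hs y
    rw [hy.2.1] at hsum
    refine ⟨k, hy.exists_step h h1 (by linarith) fun m hmk => ?_⟩
    rcases hm m with rfl | rfl | rfl
    · exact absurd rfl hmk
    · linarith [hy.1 l]
    · linarith [hy.1 d]

lemma orbitAddresses_nonempty {lam : ℝ} (h : 1 < lam ^ 3 + lam) (h1 : lam < 1)
    {y : Fin 3 → ℝ} (hy : IsNonvertex lam y) : (orbitAddresses lam y).Nonempty := by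
  choose d z hz hs using fun y : {y // IsNonvertex lam y} => y.2.exists_digit h h1
  let r : ℕ → {y // IsNonvertex lam y} := fun n => (fun w => ⟨z w, hz w⟩)^[n] ⟨y, hy⟩
  refine ⟨fun n => d (r n), fun n => (r n).1, rfl, fun n => ⟨(r n).2, ?_⟩⟩
  have : r (n + 1) = ⟨z (r n), hz (r n)⟩ := Function.iterate_succ_apply' _ _ _
  change IsStep lam (r n).1 (d (r n)) (r (n + 1)).1
  rw [this]
  exact hs _

lemma nontrivial_of_two_le_of_lt {lam : ℝ} (h : 1 < lam ^ 3 + lam) (h1 : lam < 1)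
    {y : Fin 3 → ℝ} (hy : IsNonvertex lam y) {j k : Fin 3} (hjk : j ≠ k)
    (hj : 1 ≤ y j) (hk : 1 ≤ y k) (hj' : y j < (1 - lam)⁻¹ - 1) (hk' : y k < (1 - lam)⁻¹ - 1) :
    (orbitAddresses lam y).Nontrivial := by
  obtain ⟨l, hlj, hlk, hm, hs⟩ := Fin.exists_third hjk
  have hsum := hs y
  rw [hy.2.1] at hsum
  have hlt : ∀ m, y m < (1 - lam)⁻¹ - 1 := by
    intro m
    rcases hm m with rfl | rfl | rfl
    · exact hj'
    · exact hk'
    · linarith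
  obtain ⟨z, hz, hyz⟩ := hy.exists_step h h1 hj fun m _ => hlt m
  obtain ⟨w, hw, hyw⟩ := hy.exists_step h h1 hk fun m _ => hlt m
  obtain ⟨i, hi⟩ := orbitAddresses_nonempty h h1 hz
  obtain ⟨i', hi'⟩ := orbitAddresses_nonempty h h1 hw
  exact ⟨_, cons_mem_orbitAddresses hy hyz hi, _, cons_mem_orbitAddresses hy hyw hi',
    Stream'.cons_ne_cons (Or.inl hjk)⟩

lemma nontrivial_of_two_le_of_le {lam : ℝ} (h : 1 < lam ^ 3 + lam) (h1 : lam < 1)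
    {y : Fin 3 → ℝ} (hy : IsNonvertex lam y) {j k : Fin 3} (hjk : j ≠ k)
    (hj : 1 ≤ y j) (hk : (1 - lam)⁻¹ - 1 ≤ y k) : (orbitAddresses lam y).Nontrivial := by
  have h3 := three_lt_inv h h1
  have h2 := two_thirds_lt h
  obtain ⟨l, hlj, hlk, hm, hs⟩ := Fin.exists_third hjk
  have hsum := hs y
  rw [hy.2.1] at hsum
  have hl := hy.1 l
  obtain ⟨z, hz, hyz⟩ := hy.exists_step h h1 (d := k) (by linarith) fun m hmk => by
    rcases hm m with rfl | rfl | rfl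
    · linarith
    · exact absurd rfl hmk
    · linarith
  have hzj := hyz j
  have hzk := hyz k
  rw [if_neg hjk.symm, add_zero] at hzj
  rw [if_pos rfl] at hzk
  have hzsum := hs z
  rw [hz.2.1] at hzsum
  have hzl := hz.1 l
  have hzj1 : 1 < z j := by nlinarith
  have hzj2 : z j < 2 := by nlinarith
  have hzk1 : 1 < z k := by nlinarith
  exact nontrivial_of_step hy hyz
    (nontrivial_of_two_le_of_lt h h1 hz hjk hzj1.le hzk1.le (by linarith) (by linarith))

lemma nontrivial_of_two_le {lam : ℝ} (h : 1 < lam ^ 3 + lam) (h1 : lam < 1)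
    {y : Fin 3 → ℝ} (hy : IsNonvertex lam y) {j k : Fin 3} (hjk : j ≠ k)
    (hj : 1 ≤ y j) (hk : 1 ≤ y k) : (orbitAddresses lam y).Nontrivial := by
  rcases le_or_gt ((1 - lam)⁻¹ - 1) (y k) with hk' | hk'
  · exact nontrivial_of_two_le_of_le h h1 hy hjk hj hk'
  rcases le_or_gt ((1 - lam)⁻¹ - 1) (y j) with hj' | hj'
  · exact nontrivial_of_two_le_of_le h h1 hy hjk.symm hk hj'
  exact nontrivial_of_two_le_of_lt h h1 hy hjk hj hk hj' hk'

/-- The case of a point all of whose rescaled coordinates are less than `1 / lam`. -/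
lemma nontrivial_of_mul_lt_one {lam : ℝ} (h : 1 < lam ^ 3 + lam) (h1 : lam < 1)
    {y : Fin 3 → ℝ} (hy : IsNonvertex lam y) (hlt : ∀ j, lam * y j < 1) :
    (orbitAddresses lam y).Nontrivial := by
  have h3 := three_lt_inv h h1
  have h2 := two_thirds_lt h
  obtain ⟨m, hm⟩ := hy.exists_one_le h h1
  by_cases hex : ∃ k, k ≠ m ∧ 1 ≤ y k
  · obtain ⟨k, hkm, hk⟩ := hex
    exact nontrivial_of_two_le h h1 hy hkm hk hm
  push Not at hex
  obtain ⟨w, hw, hyw⟩ := hy.exists_step h h1 hm fun k hk => by linarith [hex k hk]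
  refine nontrivial_of_step hy hyw ?_
  obtain ⟨k, hkm⟩ := exists_ne m
  obtain ⟨l, hlm, hlk, -, hs⟩ := Fin.exists_third hkm.symm
  have hws := hs w
  rw [hw.2.1] at hws
  have hwm := hyw m
  have hwk := hyw k
  have hwl := hyw l
  rw [if_pos rfl] at hwm
  rw [if_neg hkm.symm, add_zero] at hwk
  rw [if_neg hlm.symm, add_zero] at hwl
  have hk := hex k hkm
  have hl := hex l hlm
  have hM : 1 + lam ^ 2 < lam ^ 2 * (1 - lam)⁻¹ := by
    rw [← div_eq_mul_inv, lt_div_iff₀ (by linarith)]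
    nlinarith
  have hm' : lam ^ 2 * w m < 1 - lam := by nlinarith [hlt m]
  have hone : ∀ a b : ℝ, lam * a < 1 → w m + a + b = (1 - lam)⁻¹ → 1 ≤ b := by
    intro a b ha hab
    rw [← hab] at hM
    have ha' : lam ^ 2 * a < lam := by nlinarith
    by_contra! hb
    have hb' : lam ^ 2 * b < lam ^ 2 := by nlinarith [sq_pos_of_pos (show 0 < lam by linarith)]
    nlinarith
  exact nontrivial_of_two_le h h1 hw hlk (hone (w k) _ (by linarith) (by linarith))
    (hone (w l) _ (by linarith) (by linarith))

lemma nontrivial_of_pow_le {lam : ℝ} (h : 1 < lam ^ 3 + lam) (h1 : lam < 1) (n : ℕ)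
    {y : Fin 3 → ℝ} (hy : IsNonvertex lam y) {j k : Fin 3} (hjk : j ≠ k)
    (hj : 1 ≤ y j) (hk : lam ^ n ≤ y k) : (orbitAddresses lam y).Nontrivial := by
  have h3 := three_lt_inv h h1
  have hpos : 0 < lam := by linarith [two_thirds_lt h]
  induction n generalizing y with
  | zero => exact nontrivial_of_two_le h h1 hy hjk hj (by simpa using hk)
  | succ n ih =>
    by_cases hex : ∃ m, m ≠ j ∧ 1 ≤ y m
    · obtain ⟨m, hmj, hm⟩ := hex
      exact nontrivial_of_two_le h h1 hy hmj hm hj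
    push Not at hex
    obtain ⟨z, hz, hyz⟩ := hy.exists_step h h1 hj fun m hm => by linarith [hex m hm]
    refine nontrivial_of_step hy hyz ?_
    have hz' : ∀ m, m ≠ j → y m = lam * z m := fun m hm => by
      rw [hyz m, if_neg hm.symm, add_zero]
    rcases le_or_gt 1 (z j) with hzj | hzj
    · refine ih hz hzj ?_
      rw [hz' k hjk.symm, pow_succ'] at hk
      exact le_of_mul_le_mul_left hk hpos
    · refine nontrivial_of_mul_lt_one h h1 hz fun m => ?_
      rcases eq_or_ne m j with rfl | hm
      · nlinarith
      · rw [← hz' m hm]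
        exact hex m hm

lemma orbitAddresses_nontrivial {lam : ℝ} (h : 1 < lam ^ 3 + lam) (h1 : lam < 1)
    {y : Fin 3 → ℝ} (hy : IsNonvertex lam y) : (orbitAddresses lam y).Nontrivial := by
  obtain ⟨j, hj⟩ := hy.exists_one_le h h1
  obtain ⟨k, hkj, hk⟩ : ∃ k, k ≠ j ∧ 0 < y k := by
    by_contra! hle
    have : ∑ m, y m = y j :=
      Fintype.sum_eq_single j fun m hm => le_antisymm (hle m hm) (hy.1 m)
    rw [hy.2.1] at this
    linarith [hy.2.2 j]
  obtain ⟨n, hn⟩ := exists_pow_lt_of_lt_one hk h1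
  exact nontrivial_of_pow_le h h1 n hy hkj.symm hj hn.le

lemma exists_ne_agreeing {lam : ℝ} (h : 1 < lam ^ 3 + lam) (h1 : lam < 1) (n : ℕ)
    {y : Fin 3 → ℝ} {i : ℕ → Fin 3} (hi : i ∈ orbitAddresses lam y) :
    ∃ i' ∈ orbitAddresses lam y, i' ≠ i ∧ ∀ m < n, i' m = i m := by
  induction n generalizing y i with
  | zero =>
    obtain ⟨r, rfl, hr⟩ := hi
    obtain ⟨i', hi', hne⟩ := (orbitAddresses_nontrivial h h1 (hr 0).1).exists_ne i
    exact ⟨i', hi', hne, by simp⟩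
  | succ n ih =>
    obtain ⟨r, rfl, hr⟩ := hi
    obtain ⟨i', hi', hne, heq⟩ := ih (y := r 1) (i := fun m => i (m + 1))
      ⟨fun m => r (m + 1), rfl, fun m => hr (m + 1)⟩
    refine ⟨Stream'.cons (i 0) i', cons_mem_orbitAddresses (hr 0).1 (hr 0).2 hi',
      fun he => hne (funext fun m => congrFun he (m + 1)), fun m hm => ?_⟩
    cases m with
    | zero => rfl
    | succ m => exact heq m (by omega)

lemma orbitAddresses_preperfect {lam : ℝ} (h : 1 < lam ^ 3 + lam) (h1 : lam < 1)
    (y : Fin 3 → ℝ) : Preperfect (orbitAddresses lam y) := by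
  intro i hi
  rw [accPt_iff_nhds]
  intro U hU
  obtain ⟨V, ⟨x, n, rfl⟩, hx, hVU⟩ :=
    (PiNat.isTopologicalBasis_cylinders (fun _ : ℕ => Fin 3)).mem_nhds_iff.1 hU
  obtain ⟨i', hi', hne, heq⟩ := exists_ne_agreeing h h1 n hi
  exact ⟨i', ⟨hVU fun m hm => (heq m hm).trans (hx m hm), hi'⟩, hne⟩

lemma hasSum_of_mem_orbitAddresses {lam : ℝ} (hpos : 0 < lam) (h1 : lam < 1)
    {y : Fin 3 → ℝ} {i : ℕ → Fin 3} (hi : i ∈ orbitAddresses lam y) (j : Fin 3) :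
    HasSum (fun n => lam ^ n * if i n = j then 1 else 0) (y j) := by
  obtain ⟨r, rfl, hr⟩ := hi
  rw [hasSum_iff_tendsto_nat_of_nonneg (fun n => by positivity)]
  have hpart : ∀ n, ∑ m ∈ Finset.range n, lam ^ m * (if i m = j then (1 : ℝ) else 0) =
      r 0 j - lam ^ n * r n j := by
    intro n
    induction n with
    | zero => simp
    | succ n ih =>
      rw [Finset.sum_range_succ, ih, (hr n).2 j]
      ring
  simp_rw [hpart]
  have hlim : Filter.Tendsto (fun n => lam ^ n * r n j) Filter.atTop (nhds 0) := by
    refine squeeze_zero (g := fun n => lam ^ n * (1 - lam)⁻¹)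
      (fun n => mul_nonneg (by positivity) ((hr n).1.1 j))
      (fun n => mul_le_mul_of_nonneg_left ((hr n).1.2.2 j).le (by positivity)) ?_
    simpa using (tendsto_pow_atTop_nhds_zero_of_lt_one hpos.le h1).mul_const ((1 - lam)⁻¹)
  simpa using hlim.const_sub (r 0 j)

lemma hasSum_address {E : Type*} [NormedAddCommGroup E] [NormedSpace ℝ E] (p : Fin 3 → E)
    {lam : ℝ} {y : Fin 3 → ℝ} {i : ℕ → Fin 3}
    (hi : ∀ j, HasSum (fun n => lam ^ n * if i n = j then 1 else 0) (y j)) :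
    HasSum (fun n => lam ^ (n + 1) • p (i n)) (lam • ∑ j, y j • p j) := by
  convert (hasSum_sum fun j (_ : j ∈ Finset.univ) => (hi j).smul_const (p j)).const_smul lam using 2
    with n
  simp [smul_smul, pow_succ']

lemma continuous_address {E : Type*} [NormedAddCommGroup E] [NormedSpace ℝ E] [CompleteSpace E]
    (p : Fin 3 → E)
    {lam : ℝ} (hpos : 0 < lam) (h1 : lam < 1) :
    Continuous fun i : ℕ → Fin 3 => ∑' n : ℕ, lam ^ (n + 1) • p (i n) := by
  refine continuous_tsum (u := fun n => lam ^ (n + 1) * ∑ j, ‖p j‖)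
    (fun n => ?_) ?_ fun n i => ?_
  · have hp : Continuous p := continuous_of_discreteTopology
    fun_prop
  · exact ((summable_nat_add_iff 1).2 (summable_geometric_of_lt_one hpos.le h1)).mul_right _
  · rw [norm_smul, Real.norm_of_nonneg (by positivity)]
    exact mul_le_mul_of_nonneg_left
      (Finset.single_le_sum (f := fun j => ‖p j‖) (fun j _ => norm_nonneg _) (Finset.mem_univ _))
      (by positivity)

/-- Triangular case: if `λ ∈ (λ_0, 1)` where `λ_0` is the unique positive root
of `x³ + x = 1`, then every point of the attractor other than the vertices
`p_0, p_1, p_2` has a continuum of distinct addresses. -/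
theorem stmt19 (p : Fin 3 → EuclideanSpace ℝ (Fin 2)) (hp : AffineIndependent ℝ p)
    (lam0 : ℝ) (hlam0pos : 0 < lam0) (hroot : lam0 ^ 3 + lam0 = 1)
    (lam : ℝ) (h0 : lam0 < lam) (h1 : lam < 1) :
    ∀ x : EuclideanSpace ℝ (Fin 2),
      (∃ i : ℕ → Fin 3, x = (lam⁻¹ - 1) • ∑' n : ℕ, lam ^ (n + 1) • p (i n)) →
      x ∉ ({p 0, p 1, p 2} : Set (EuclideanSpace ℝ (Fin 2))) →
      Cardinal.mk {i : ℕ → Fin 3 //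
        x = (lam⁻¹ - 1) • ∑' n : ℕ, lam ^ (n + 1) • p (i n)} = Cardinal.continuum := by
  rintro x ⟨i, hx⟩ hxp
  have hpos : 0 < lam := hlam0pos.trans h0
  have h : 1 < lam ^ 3 + lam := by
    have := pow_lt_pow_left₀ h0 hlam0pos.le (n := 3) (by norm_num)
    linarith
  have hgeom := hasSum_geometric_of_lt_one hpos.le h1
  let y : Fin 3 → ℝ := fun j => ∑' n, lam ^ n * if i n = j then 1 else 0
  have hiy : ∀ j, HasSum (fun n => lam ^ n * if i n = j then 1 else 0) (y j) := fun j =>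
    (hgeom.summable.of_nonneg_of_le (fun n => by positivity) fun n =>
      mul_le_of_le_one_right (by positivity) (by split_ifs <;> norm_num)).hasSum
  have hnn : ∀ j, 0 ≤ y j := fun j => tsum_nonneg fun n => by positivity
  have hsum : ∑ j, y j = (1 - lam)⁻¹ := by
    refine (hasSum_sum fun j (_ : j ∈ Finset.univ) => hiy j).unique ?_
    convert hgeom using 2 with n
    simp
  have hxy : x = (lam⁻¹ - 1) • lam • ∑ j, y j • p j := by
    rw [hx, (hasSum_address p hiy).tsum_eq]
  have hy : IsNonvertex lam y := by
    refine ⟨hnn, hsum, fun j => lt_of_le_of_ne ?_ fun hj => hxp ?_⟩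
    · rw [← hsum]
      exact Finset.single_le_sum (fun k _ => hnn k) (Finset.mem_univ j)
    · have hz : ∀ k, k ≠ j → y k = 0 := by
        intro k hkj
        obtain ⟨l, -, -, -, hs⟩ := Fin.exists_third hkj
        have := hs y
        linarith [hnn k, hnn l]
      have hxj : x = p j := by
        rw [hxy, Fintype.sum_eq_single j fun k hk => by rw [hz k hk, zero_smul], hj, smul_smul,
          smul_smul]
        have h1' : 1 - lam ≠ 0 := by linarith
        convert one_smul ℝ (p j) using 2
        field_simp
      rw [hxj]
      fin_cases j <;> simp
  set A : Set (ℕ → Fin 3) := {i | x = (lam⁻¹ - 1) • ∑' n : ℕ, lam ^ (n + 1) • p (i n)} with hA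
  have hclosed : IsClosed A := by
    have hc := continuous_address p hpos h1
    exact isClosed_eq continuous_const (by fun_prop)
  have hsub : closure (orbitAddresses lam y) ⊆ A := by
    refine closure_minimal (fun i' hi' => ?_) hclosed
    rw [hA, Set.mem_ofPred_eq, hxy,
      (hasSum_address p fun j => hasSum_of_mem_orbitAddresses hpos h1 hi' j).tsum_eq]
  let := TopologicalSpace.upgradeIsCompletelyMetrizable (ℕ → Fin 3)
  obtain ⟨f, hf, -, hfinj⟩ :=
    (orbitAddresses_preperfect h h1 y).perfect_closure.exists_nat_bool_injection
      (orbitAddresses_nonempty h h1 hy).closure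
  apply le_antisymm
  · calc Cardinal.mk A ≤ Cardinal.mk (ℕ → Fin 3) := Cardinal.mk_set_le A
      _ = Cardinal.continuum := by
        simpa using Cardinal.nat_power_aleph0 (n := 3) (by norm_num)
  · calc Cardinal.continuum = Cardinal.mk (ℕ → Bool) := by simp
      _ ≤ Cardinal.mk A := Cardinal.mk_le_of_injective
        (f := fun b => (⟨f b, hsub (hf ⟨b, rfl⟩)⟩ : A))
        fun b c hbc => hfinj (congrArg Subtype.val hbc)
end
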